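/- The subgroup $\widehat{G}_+ = \{M \in Sp(4,\mathbb{R}) \mid MQ = QM\}$ acts transitively on $\widehat{\mathbb{H}}_2$: for any $\Omega_1, \Omega_2 \in \widehat{\mathbb{H}}_2$ there exists $M \in \widehat{G}_+$ with $M\langle\Omega_1\rangle = \Omega_2$. -/

import Mathlib

open Matrix Complex

noncomputable section

/-- `J₄ = [[0, I₂], [-I₂, 0]]`. -/
def J4 : Matrix (Fin 4) (Fin 4) ℝ :=
  !![0,0,1,0; 0,0,0,1; -1,0,0,0; 0,-1,0,0]

/-- The symplectic group `Sp(4,ℝ)`. -/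
def Sp4 : Set (Matrix (Fin 4) (Fin 4) ℝ) :=
  {M | IsUnit M.det ∧ Mᵀ * J4 * M = J4}

/-- `Q = [[q, 0], [0, q]]` with `q = [[0,1],[1,0]]`. -/
def QM : Matrix (Fin 4) (Fin 4) ℝ :=
  !![0,1,0,0; 1,0,0,0; 0,0,0,1; 0,0,1,0]

/-- Upper-left 2×2 block (complexified). -/
def blkA (M : Matrix (Fin 4) (Fin 4) ℝ) : Matrix (Fin 2) (Fin 2) ℂ :=
  Matrix.of fun i j => (M (Fin.castAdd 2 i) (Fin.castAdd 2 j) : ℂ)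

def blkB (M : Matrix (Fin 4) (Fin 4) ℝ) : Matrix (Fin 2) (Fin 2) ℂ :=
  Matrix.of fun i j => (M (Fin.castAdd 2 i) (Fin.natAdd 2 j) : ℂ)

def blkC (M : Matrix (Fin 4) (Fin 4) ℝ) : Matrix (Fin 2) (Fin 2) ℂ :=
  Matrix.of fun i j => (M (Fin.natAdd 2 i) (Fin.castAdd 2 j) : ℂ)

def blkD (M : Matrix (Fin 4) (Fin 4) ℝ) : Matrix (Fin 2) (Fin 2) ℂ :=
  Matrix.of fun i j => (M (Fin.natAdd 2 i) (Fin.natAdd 2 j) : ℂ)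

/-- The action `M⟨Ω⟩ = (AΩ + B)(CΩ + D)⁻¹`. -/
def act (M : Matrix (Fin 4) (Fin 4) ℝ) (Ω : Matrix (Fin 2) (Fin 2) ℂ) :
    Matrix (Fin 2) (Fin 2) ℂ :=
  (blkA M * Ω + blkB M) * (blkC M * Ω + blkD M)⁻¹

/-- The Siegel upper half plane of degree 2. -/
def H2 : Set (Matrix (Fin 2) (Fin 2) ℂ) :=
  {Ω | Ωᵀ = Ω ∧ (Matrix.of fun i j => (Ω i j).im : Matrix (Fin 2) (Fin 2) ℝ).PosDef}

/-- The new kind Siegel upper half space `Ĥ₂ = {Ω ∈ H₂ | Q⟨Ω⟩ = Ω}`. -/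
def HHat2 : Set (Matrix (Fin 2) (Fin 2) ℂ) :=
  {Ω | Ω ∈ H2 ∧ act QM Ω = Ω}

/-- `Ĝ₊ = {M ∈ Sp(4,ℝ) | MQ = QM}`. -/
def GPlus : Set (Matrix (Fin 4) (Fin 4) ℝ) :=
  {M | M ∈ Sp4 ∧ M * QM = QM * M}

/-- The symmetric circulant `2 × 2` matrix with eigenvalues `u` (on `(1, 1)`) and `v` (on
`(1, -1)`). -/
def circ (u v : ℂ) : Matrix (Fin 2) (Fin 2) ℂ :=
  !![(u + v) / 2, (u - v) / 2; (u - v) / 2, (u + v) / 2]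

lemma circ_mul (u v u' v' : ℂ) : circ u v * circ u' v' = circ (u * u') (v * v') := by
  ext i j
  fin_cases i <;> fin_cases j <;> simp [circ, Matrix.mul_apply, Fin.sum_univ_two] <;> ring

lemma circ_add (u v u' v' : ℂ) : circ u v + circ u' v' = circ (u + u') (v + v') := by
  ext i j
  fin_cases i <;> fin_cases j <;> simp [circ] <;> ring

lemma circ_one : circ (1 : ℂ) 1 = 1 := by
  ext i j
  fin_cases i <;> fin_cases j <;> simp [circ]

lemma circ_inv {u v : ℂ} (hu : u ≠ 0) (hv : v ≠ 0) : (circ u v)⁻¹ = circ u⁻¹ v⁻¹ := by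
  apply Matrix.inv_eq_right_inv
  rw [circ_mul, mul_inv_cancel₀ hu, mul_inv_cancel₀ hv, circ_one]

/-- The action of `QM` is conjugation by the swap matrix. -/
lemma act_QM (Ω : Matrix (Fin 2) (Fin 2) ℂ) :
    act QM Ω = !![Ω 1 1, Ω 1 0; Ω 0 1, Ω 0 0] := by
  have hA : blkA QM = circ 1 (-1) := by
    ext i j
    fin_cases i <;> fin_cases j <;> simp [blkA, QM, circ]
  have hB : blkB QM = 0 := by
    ext i j
    fin_cases i <;> fin_cases j <;> simp [blkB, QM]
  have hC : blkC QM = 0 := by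
    ext i j
    fin_cases i <;> fin_cases j <;> simp [blkC, QM]
  have hD : blkD QM = circ 1 (-1) := by
    ext i j
    fin_cases i <;> fin_cases j <;> simp [blkD, QM, circ]
  rw [act, hA, hB, hC, hD, zero_mul, zero_add, add_zero, circ_inv one_ne_zero (by simp)]
  ext i j
  fin_cases i <;> fin_cases j <;>
    simp [circ, Matrix.mul_apply, Matrix.vecMul, dotProduct, Fin.sum_univ_two]

/-- Every point of `HHat2` is circulant, with eigenvalues in the upper half plane. -/
lemma exists_eq_circ_of_mem_HHat2 {Ω : Matrix (Fin 2) (Fin 2) ℂ} (h : Ω ∈ HHat2) :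
    ∃ u v : ℂ, 0 < u.im ∧ 0 < v.im ∧ Ω = circ u v := by
  obtain ⟨⟨hsymm, hpos⟩, hfix⟩ := h
  rw [act_QM] at hfix
  have h11 : Ω 1 1 = Ω 0 0 := by simpa using congrFun (congrFun hfix 0) 0
  have h10 : Ω 1 0 = Ω 0 1 := congrFun (congrFun hsymm 0) 1
  have hp := hpos.dotProduct_mulVec_pos (x := ![1, 1]) (by simp)
  have hm := hpos.dotProduct_mulVec_pos (x := ![1, -1]) (by simp)
  simp [Matrix.mulVec, dotProduct, Fin.sum_univ_two, h11, h10] at hp hm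
  refine ⟨Ω 0 0 + Ω 0 1, Ω 0 0 - Ω 0 1, ?_, ?_, ?_⟩
  · rw [add_im]
    linarith
  · rw [sub_im]
    linarith
  · ext i j
    fin_cases i <;> fin_cases j <;> simp [circ, h11, h10]

/-- The block upper triangular matrix with circulant blocks acting on the eigenvalues of a
circulant matrix by `u ↦ s ^ 2 * u + s * x` and `v ↦ t ^ 2 * v + t * y`. -/
def affineMat (s t x y : ℝ) : Matrix (Fin 4) (Fin 4) ℝ :=
  !![(s + t) / 2, (s - t) / 2, (x + y) / 2, (x - y) / 2;
    (s - t) / 2, (s + t) / 2, (x - y) / 2, (x + y) / 2;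
    0, 0, (s⁻¹ + t⁻¹) / 2, (s⁻¹ - t⁻¹) / 2;
    0, 0, (s⁻¹ - t⁻¹) / 2, (s⁻¹ + t⁻¹) / 2]

lemma affineMat_mem_GPlus {s t : ℝ} (hs : s ≠ 0) (ht : t ≠ 0) (x y : ℝ) :
    affineMat s t x y ∈ GPlus := by
  have hJ : (affineMat s t x y)ᵀ * J4 * affineMat s t x y = J4 := by
    ext i j
    fin_cases i <;> fin_cases j <;>
      simp [affineMat, J4, Matrix.mul_apply, Fin.sum_univ_four] <;> field_simp <;> ring
  have hJJ : J4 * J4 = -1 := by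
    ext i j
    fin_cases i <;> fin_cases j <;> simp [J4, Matrix.mul_apply, Fin.sum_univ_four]
  refine ⟨⟨?_, hJ⟩, ?_⟩
  · apply Matrix.isUnit_det_of_left_inverse (B := -(J4 * ((affineMat s t x y)ᵀ * J4)))
    rw [neg_mul, mul_assoc, hJ, hJJ, neg_neg]
  · ext i j
    fin_cases i <;> fin_cases j <;>
      simp [affineMat, QM, Matrix.mul_apply, Fin.sum_univ_four]

lemma act_affineMat_circ {s t : ℝ} (hs : s ≠ 0) (ht : t ≠ 0) (x y : ℝ) (u v : ℂ) :
    act (affineMat s t x y) (circ u v) = circ (s ^ 2 * u + s * x) (t ^ 2 * v + t * y) := by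
  have hA : blkA (affineMat s t x y) = circ (s : ℂ) t := by
    ext i j
    fin_cases i <;> fin_cases j <;> simp [blkA, affineMat, circ]
  have hB : blkB (affineMat s t x y) = circ (x : ℂ) y := by
    ext i j
    fin_cases i <;> fin_cases j <;> simp [blkB, affineMat, circ]
  have hC : blkC (affineMat s t x y) = 0 := by
    ext i j
    fin_cases i <;> fin_cases j <;> simp [blkC, affineMat]
  have hD : blkD (affineMat s t x y) = circ (s : ℂ)⁻¹ (t : ℂ)⁻¹ := by
    ext i j
    fin_cases i <;> fin_cases j <;> simp [blkD, affineMat, circ]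
  rw [act, hA, hB, hC, hD, zero_mul, zero_add,
    circ_inv (by simpa using hs) (by simpa using ht), inv_inv, inv_inv, circ_mul, circ_add,
    circ_mul]
  congr 1 <;> ring

/-- Real affine maps `u ↦ s ^ 2 * u + s * x` act transitively on the upper half plane. -/
lemma exists_affine_eq {u u' : ℂ} (hu : 0 < u.im) (hu' : 0 < u'.im) :
    ∃ s x : ℝ, s ≠ 0 ∧ (s : ℂ) ^ 2 * u + s * x = u' := by
  have hr : 0 < u'.im / u.im := div_pos hu' hu
  obtain ⟨s, hs, hs2⟩ : ∃ s : ℝ, s ≠ 0 ∧ s ^ 2 = u'.im / u.im :=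
    ⟨√(u'.im / u.im), (Real.sqrt_pos.2 hr).ne', Real.sq_sqrt hr.le⟩
  refine ⟨s, (u'.re - s ^ 2 * u.re) / s, hs, ?_⟩
  rw [← ofReal_pow, ← ofReal_mul, mul_div_cancel₀ _ hs]
  apply Complex.ext
  · rw [add_re, re_ofReal_mul, ofReal_re]
    ring
  · rw [add_im, im_ofReal_mul, ofReal_im, hs2, div_mul_cancel₀ _ hu.ne', add_zero]

/-- `Ĝ₊` acts transitively on `Ĥ₂`. -/
theorem statement15 :
    ∀ Ω₁ ∈ HHat2, ∀ Ω₂ ∈ HHat2, ∃ M ∈ GPlus, act M Ω₁ = Ω₂ := by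
  intro Ω₁ h₁ Ω₂ h₂
  obtain ⟨u, v, hu, hv, rfl⟩ := exists_eq_circ_of_mem_HHat2 h₁
  obtain ⟨u', v', hu', hv', rfl⟩ := exists_eq_circ_of_mem_HHat2 h₂
  obtain ⟨s, x, hs, hsx⟩ := exists_affine_eq hu hu'
  obtain ⟨t, y, ht, hty⟩ := exists_affine_eq hv hv'
  exact ⟨affineMat s t x y, affineMat_mem_GPlus hs ht x y, by
    rw [act_affineMat_circ hs ht, hsx, hty]⟩

end
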